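/- Let C_G(E) denote the capacity of the average-intensity-constrained Gaussian optical intensity channel. Then for every E > 0 and every t > 0, C_G(E) ≤ e^{-t²/2}/(1 − e^{-t²/2}) + (t/2 + 1)·φ(t) + 2E/t + (2 + 1/(2√(2π)))·E + E·t/2. -/

import Mathlib

open MeasureTheory ProbabilityTheory Filter
open scoped Classical

/-- Kullback–Leibler divergence (natural logarithm), with value `⊤` when it is
not defined as a real number. -/
noncomputable def klDiv {α : Type*} [MeasurableSpace α] (μ ν : Measure α) : EReal :=
  if μ ≪ ν ∧ Integrable (fun x => Real.log (μ.rnDeriv ν x).toReal) μ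
  then ((∫ x, Real.log (μ.rnDeriv ν x).toReal ∂μ : ℝ) : EReal)
  else ⊤

/-- Mutual information between the input `X ~ μ` and the output `Y = X + Z` of the
Gaussian optical intensity channel, where `Z ~ N(0,1)` is independent of `X`:
the KL divergence between the joint law of `(X, X + Z)` and the product of its
two marginals. -/
noncomputable def gaussianMI (μ : Measure ℝ) : EReal :=
  let joint : Measure (ℝ × ℝ) :=
    (μ.prod (gaussianReal 0 1)).map (fun p => (p.1, p.1 + p.2))
  klDiv joint (joint.fst.prod joint.snd)

/-- Capacity of the average-intensity-constrained Gaussian optical intensity channel: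
the supremum of the mutual information over all probability measures on `ℝ`
concentrated on `[0, ∞)` with mean at most `E`. -/
noncomputable def C_G (E : ℝ) : EReal :=
  ⨆ (μ : Measure ℝ) (_ : IsProbabilityMeasure μ) (_ : μ (Set.Iio 0) = 0)
    (_ : ∫⁻ x, ENNReal.ofReal x ∂μ ≤ ENNReal.ofReal E), gaussianMI μ

/-- The standard normal density. -/
noncomputable def stdNormalPDF (x : ℝ) : ℝ :=
  (1 / Real.sqrt (2 * Real.pi)) * Real.exp (-x ^ 2 / 2)

open scoped ENNReal

/-- The joint law of the input `X ~ μ` and the output `X + Z` of the Gaussian channel. -/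
noncomputable def gaussianJoint (μ : Measure ℝ) : Measure (ℝ × ℝ) :=
  (μ.prod (gaussianReal 0 1)).map (fun p => (p.1, p.1 + p.2))

/-- The Lebesgue density of the output of the Gaussian channel with input law `μ`. -/
noncomputable def outputPDF (μ : Measure ℝ) (y : ℝ) : ℝ≥0∞ :=
  ∫⁻ x, gaussianPDF x 1 y ∂μ

/-- The exponent of the reference output density: quadratic up to `t`, linear beyond `t`. -/
noncomputable def refExponent (t y : ℝ) : ℝ :=
  if y ≤ t then y ^ 2 / 2 else t * y / 2

/-- The (unnormalised) reference output density: Gaussian up to `t`, exponential beyond `t`. -/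
noncomputable def refDensity (t y : ℝ) : ℝ :=
  1 / Real.sqrt (2 * Real.pi) * Real.exp (-refExponent t y)

lemma measurable_refDensity (t : ℝ) : Measurable (refDensity t) := by
  unfold refDensity refExponent
  refine Measurable.const_mul (Real.measurable_exp.comp (Measurable.neg ?_)) _
  exact Measurable.ite measurableSet_Iic (by fun_prop) (by fun_prop)

lemma refDensity_pos (t y : ℝ) : 0 < refDensity t y := by
  unfold refDensity; positivity

lemma gaussianPDFReal_one (x y : ℝ) :
    gaussianPDFReal x 1 y = 1 / Real.sqrt (2 * Real.pi) * Real.exp (-(y - x) ^ 2 / 2) := by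
  simp [gaussianPDFReal]

lemma measurable_gaussianPDF_prod : Measurable (fun p : ℝ × ℝ => gaussianPDF p.1 1 p.2) :=
  measurable_uncurry_gaussianPDF.comp
    (by fun_prop : Measurable fun p : ℝ × ℝ => (p.1, (1 : NNReal), p.2))

lemma measurable_gaussianPDF_mean (y : ℝ) : Measurable (fun x => gaussianPDF x 1 y) := by
  unfold gaussianPDF gaussianPDFReal
  fun_prop

lemma measurable_outputPDF (μ : Measure ℝ) [SFinite μ] : Measurable (outputPDF μ) :=
  measurable_gaussianPDF_prod.lintegral_prod_left'

lemma outputPDF_le (μ : Measure ℝ) [IsProbabilityMeasure μ] (y : ℝ) :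
    outputPDF μ y ≤ ENNReal.ofReal (1 / Real.sqrt (2 * Real.pi)) := by
  calc outputPDF μ y ≤ ∫⁻ _, ENNReal.ofReal (1 / Real.sqrt (2 * Real.pi)) ∂μ := by
        refine lintegral_mono fun x => ENNReal.ofReal_le_ofReal ?_
        rw [gaussianPDFReal_one]
        refine mul_le_of_le_one_right (by positivity) (Real.exp_le_one_iff.2 ?_)
        nlinarith [sq_nonneg (y - x)]
    _ = _ := by simp

lemma outputPDF_ne_top (μ : Measure ℝ) [IsProbabilityMeasure μ] (y : ℝ) : outputPDF μ y ≠ ∞ :=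
  ne_top_of_le_ne_top ENNReal.ofReal_ne_top (outputPDF_le μ y)

lemma outputPDF_ne_zero (μ : Measure ℝ) [IsProbabilityMeasure μ] (y : ℝ) : outputPDF μ y ≠ 0 := by
  intro h
  have h0 : ∀ᵐ x ∂μ, False := by
    filter_upwards [(lintegral_eq_zero_iff (measurable_gaussianPDF_mean y)).1 h] with x hx
    exact (gaussianPDF_pos x one_ne_zero y).ne' hx
  simp [IsProbabilityMeasure.ne_zero μ] at h0

lemma gaussianJoint_eq_withDensity (μ : Measure ℝ) [SFinite μ] :
    gaussianJoint μ = (μ.prod volume).withDensity (fun p => gaussianPDF p.1 1 p.2) := by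
  refine Measure.ext_of_lintegral _ fun g hg => ?_
  have hm : Measurable (fun p : ℝ × ℝ => (p.1, p.1 + p.2)) := by fun_prop
  rw [gaussianJoint, lintegral_map hg hm,
    lintegral_prod (fun p : ℝ × ℝ => g (p.1, p.1 + p.2)) (hg.comp hm).aemeasurable,
    lintegral_withDensity_eq_lintegral_mul _ measurable_gaussianPDF_prod hg,
    lintegral_prod _ (measurable_gaussianPDF_prod.mul hg).aemeasurable]
  refine lintegral_congr fun x => ?_
  have hgx : Measurable (fun y => g (x, y)) := hg.comp measurable_prodMk_left
  have h := gaussianReal_map_const_add (μ := 0) (v := 1) x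
  rw [zero_add] at h
  rw [← lintegral_map (f := fun y => g (x, y)) hgx (measurable_const_add x), h,
    gaussianReal_of_var_ne_zero _ one_ne_zero,
    lintegral_withDensity_eq_lintegral_mul _ (measurable_gaussianPDF x 1) hgx]
  rfl

instance isProbabilityMeasure_gaussianJoint (μ : Measure ℝ) [IsProbabilityMeasure μ] :
    IsProbabilityMeasure (gaussianJoint μ) :=
  Measure.isProbabilityMeasure_map (by fun_prop)

lemma fst_gaussianJoint (μ : Measure ℝ) [IsProbabilityMeasure μ] : (gaussianJoint μ).fst = μ := by
  rw [Measure.fst, gaussianJoint, Measure.map_map measurable_fst (by fun_prop)]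
  exact Measure.fst_prod

lemma snd_gaussianJoint (μ : Measure ℝ) [SFinite μ] :
    (gaussianJoint μ).snd = volume.withDensity (outputPDF μ) := by
  refine Measure.ext_of_lintegral _ fun g hg => ?_
  have hg2 : Measurable (fun p : ℝ × ℝ => g p.2) := hg.comp measurable_snd
  rw [Measure.snd, lintegral_map hg measurable_snd, gaussianJoint_eq_withDensity,
    lintegral_withDensity_eq_lintegral_mul _ measurable_gaussianPDF_prod hg2,
    lintegral_prod_symm _ (measurable_gaussianPDF_prod.mul hg2).aemeasurable,
    lintegral_withDensity_eq_lintegral_mul _ (measurable_outputPDF μ) hg]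
  refine lintegral_congr fun y => ?_
  exact lintegral_mul_const (g y) (measurable_gaussianPDF_mean y)

lemma measurable_infoDensity (μ : Measure ℝ) [SFinite μ] :
    Measurable (fun p : ℝ × ℝ => gaussianPDF p.1 1 p.2 / outputPDF μ p.2) :=
  measurable_gaussianPDF_prod.div ((measurable_outputPDF μ).comp measurable_snd)

lemma gaussianJoint_eq_withDensity_prod (μ : Measure ℝ) [IsProbabilityMeasure μ] :
    gaussianJoint μ = ((gaussianJoint μ).fst.prod (gaussianJoint μ).snd).withDensity
      (fun p => gaussianPDF p.1 1 p.2 / outputPDF μ p.2) := by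
  rw [fst_gaussianJoint, snd_gaussianJoint, prod_withDensity_right (measurable_outputPDF μ),
    ← withDensity_mul (f := fun p : ℝ × ℝ => outputPDF μ p.2) _
      ((measurable_outputPDF μ).comp measurable_snd) (measurable_infoDensity μ),
    gaussianJoint_eq_withDensity]
  congr 1
  ext p
  exact (ENNReal.mul_div_cancel (outputPDF_ne_zero μ p.2) (outputPDF_ne_top μ p.2)).symm

lemma gaussianMI_le_of_integral_le (μ : Measure ℝ) [IsProbabilityMeasure μ] {b : ℝ}
    (hi : Integrable (fun p => Real.log (gaussianPDF p.1 1 p.2 / outputPDF μ p.2).toReal)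
      (gaussianJoint μ))
    (hb : ∫ p, Real.log (gaussianPDF p.1 1 p.2 / outputPDF μ p.2).toReal ∂(gaussianJoint μ) ≤ b) :
    gaussianMI μ ≤ b := by
  have hJ := gaussianJoint_eq_withDensity_prod μ
  have hac : gaussianJoint μ ≪ (gaussianJoint μ).fst.prod (gaussianJoint μ).snd := by
    conv_lhs => rw [hJ]
    exact withDensity_absolutelyContinuous _ _
  have hrn := Measure.rnDeriv_withDensity ((gaussianJoint μ).fst.prod (gaussianJoint μ).snd)
    (measurable_infoDensity μ)
  rw [← hJ] at hrn
  have hlog : (fun p => Real.log ((gaussianJoint μ).rnDeriv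
      ((gaussianJoint μ).fst.prod (gaussianJoint μ).snd) p).toReal) =ᵐ[gaussianJoint μ]
      fun p => Real.log (gaussianPDF p.1 1 p.2 / outputPDF μ p.2).toReal := by
    filter_upwards [hac.ae_le hrn] with p hp
    rw [hp]
  change klDiv (gaussianJoint μ) ((gaussianJoint μ).fst.prod (gaussianJoint μ).snd) ≤ b
  rw [klDiv, if_pos ⟨hac, hi.congr hlog.symm⟩, integral_congr_ae hlog]
  exact_mod_cast hb

lemma lintegral_refDensity_le {t : ℝ} (ht : 0 < t) :
    ∫⁻ y, ENNReal.ofReal (refDensity t y) ≤ ENNReal.ofReal (1 + 2 * stdNormalPDF t / t) := by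
  have ha : -t / 2 < 0 := by linarith
  have hpt : ∀ y, ENNReal.ofReal (refDensity t y) ≤ gaussianPDF 0 1 y +
      (Set.Ioi t).indicator (fun y => ENNReal.ofReal
        (1 / Real.sqrt (2 * Real.pi) * Real.exp (-t / 2 * y))) y := by
    intro y
    by_cases h : y ≤ t
    · refine le_trans (le_of_eq ?_) le_self_add
      rw [gaussianPDF, gaussianPDFReal_one, refDensity, refExponent, if_pos h]
      congr 3; ring
    · rw [Set.indicator_of_mem (by simpa using h)]
      refine le_trans (le_of_eq ?_) le_add_self
      rw [refDensity, refExponent, if_neg h]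
      congr 3; ring
  calc _ ≤ ∫⁻ y, (gaussianPDF 0 1 y + (Set.Ioi t).indicator (fun y => ENNReal.ofReal
        (1 / Real.sqrt (2 * Real.pi) * Real.exp (-t / 2 * y))) y) := lintegral_mono hpt
    _ = 1 + ENNReal.ofReal (2 * stdNormalPDF t / t) := by
        rw [lintegral_add_left (measurable_gaussianPDF 0 1),
          lintegral_gaussianPDF_eq_one 0 one_ne_zero, lintegral_indicator measurableSet_Ioi,
          ← ofReal_integral_eq_lintegral_ofReal
            ((integrableOn_exp_mul_Ioi ha t).const_mul _) (ae_of_all _ fun y => by positivity),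
          integral_const_mul, integral_exp_mul_Ioi ha, stdNormalPDF]
        congr 2
        have : -t / 2 * t = -t ^ 2 / 2 := by ring
        rw [this]
        field_simp
    _ = _ := by
        have : 0 ≤ 2 * stdNormalPDF t / t := by unfold stdNormalPDF; positivity
        rw [ENNReal.ofReal_add zero_le_one this, ENNReal.ofReal_one]

lemma refExponent_add_le {t x : ℝ} (ht : 0 < t) (hx : 0 ≤ x) (z : ℝ) :
    refExponent t (x + z) ≤ t * x / 2 + z ^ 2 / 2 + x * ((1 + z ^ 2) / 2) := by
  have h1 : x * z ≤ x * ((1 + z ^ 2) / 2) :=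
    mul_le_mul_of_nonneg_left (by nlinarith [sq_nonneg (z - 1)]) hx
  have h2 : -(x * z) ≤ x * ((1 + z ^ 2) / 2) := by
    rw [← mul_neg]
    exact mul_le_mul_of_nonneg_left (by nlinarith [sq_nonneg (z + 1)]) hx
  have h3 : 0 ≤ x * ((1 + z ^ 2) / 2) := by positivity
  rcases le_total x t with hxt | hxt
  · have hsq : x ^ 2 ≤ t * x := by nlinarith
    have hle : refExponent t (x + z) ≤ (x + z) ^ 2 / 2 := by
      unfold refExponent
      split_ifs with h
      · exact le_rfl
      · nlinarith
    nlinarith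
  · have htz : t * |z| ≤ x * ((1 + z ^ 2) / 2) := by
      have : |z| ≤ (1 + z ^ 2) / 2 := by nlinarith [sq_nonneg (|z| - 1), sq_abs z]
      exact mul_le_mul hxt this (abs_nonneg z) hx
    have htz1 : t * z ≤ t * |z| := mul_le_mul_of_nonneg_left (le_abs_self z) ht.le
    unfold refExponent
    split_ifs with h
    · rcases le_total 0 (x + z) with hy | hy
      · nlinarith [sq_nonneg z]
      · nlinarith [mul_nonneg ht.le hx]
    · nlinarith [sq_nonneg z]

lemma log_infoDensity_add (μ : Measure ℝ) [IsProbabilityMeasure μ] (x z : ℝ) :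
    Real.log (gaussianPDF x 1 (x + z) / outputPDF μ (x + z)).toReal =
      Real.log (1 / Real.sqrt (2 * Real.pi)) - z ^ 2 / 2 -
        Real.log (outputPDF μ (x + z)).toReal := by
  have hf : 0 < (outputPDF μ (x + z)).toReal :=
    ENNReal.toReal_pos (outputPDF_ne_zero μ _) (outputPDF_ne_top μ _)
  rw [ENNReal.toReal_div, toReal_gaussianPDF, gaussianPDFReal_one,
    Real.log_div (by positivity) hf.ne', Real.log_mul (by positivity) (by positivity), Real.log_exp]
  ring

lemma neg_le_log_infoDensity_add (μ : Measure ℝ) [IsProbabilityMeasure μ] (x z : ℝ) :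
    -(z ^ 2 / 2) ≤ Real.log (gaussianPDF x 1 (x + z) / outputPDF μ (x + z)).toReal := by
  have hf : 0 < (outputPDF μ (x + z)).toReal :=
    ENNReal.toReal_pos (outputPDF_ne_zero μ _) (outputPDF_ne_top μ _)
  have := Real.log_le_log hf (ENNReal.toReal_le_of_le_ofReal (by positivity) (outputPDF_le μ (x + z)))
  rw [log_infoDensity_add]
  linarith

lemma log_infoDensity_add_le (μ : Measure ℝ) [IsProbabilityMeasure μ] {t x : ℝ} (ht : 0 < t)
    (hx : 0 ≤ x) (z : ℝ) :
    Real.log (gaussianPDF x 1 (x + z) / outputPDF μ (x + z)).toReal ≤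
      t * x / 2 + x * ((1 + z ^ 2) / 2) +
        (ENNReal.ofReal (refDensity t (x + z)) / outputPDF μ (x + z)).toReal - 1 := by
  have hf : 0 < (outputPDF μ (x + z)).toReal :=
    ENNReal.toReal_pos (outputPDF_ne_zero μ _) (outputPDF_ne_top μ _)
  have hr := refDensity_pos t (x + z)
  have hlog := Real.log_le_sub_one_of_pos (div_pos hr hf)
  rw [Real.log_div hr.ne' hf.ne', refDensity, Real.log_mul (by positivity) (by positivity),
    Real.log_exp, ← refDensity] at hlog
  rw [log_infoDensity_add, ENNReal.toReal_div, ENNReal.toReal_ofReal hr.le]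
  linarith [refExponent_add_le ht hx z]

lemma lintegral_refDensity_div_outputPDF (μ : Measure ℝ) [IsProbabilityMeasure μ] (t : ℝ) :
    ∫⁻ p, ENNReal.ofReal (refDensity t p.2) / outputPDF μ p.2 ∂(gaussianJoint μ) =
      ∫⁻ y, ENNReal.ofReal (refDensity t y) := by
  have hm : Measurable (fun y => ENNReal.ofReal (refDensity t y) / outputPDF μ y) :=
    (measurable_refDensity t).ennreal_ofReal.div (measurable_outputPDF μ)
  rw [← lintegral_map hm measurable_snd, ← Measure.snd, snd_gaussianJoint,
    lintegral_withDensity_eq_lintegral_mul _ (measurable_outputPDF μ) hm]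
  exact lintegral_congr fun y =>
    ENNReal.mul_div_cancel (outputPDF_ne_zero μ y) (outputPDF_ne_top μ y)

lemma integrable_sq_gaussianReal : Integrable (fun z : ℝ => z ^ 2) (gaussianReal 0 1) :=
  (memLp_id_gaussianReal 2).integrable_sq

lemma integral_sq_gaussianReal : ∫ z : ℝ, z ^ 2 ∂(gaussianReal 0 1) = 1 := by
  have h := variance_id_gaussianReal (μ := 0) (v := 1)
  rw [variance_of_integral_eq_zero aemeasurable_id (by simp)] at h
  simpa using h

/-- The duality bound with the reference density `refDensity t`. -/
lemma gaussianMI_le (μ : Measure ℝ) [IsProbabilityMeasure μ] {E t : ℝ} (hE : 0 < E) (ht : 0 < t)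
    (hμ : μ (Set.Iio 0) = 0) (hmean : ∫⁻ x, ENNReal.ofReal x ∂μ ≤ ENNReal.ofReal E) :
    gaussianMI μ ≤ ((2 * stdNormalPDF t / t + (t / 2 + 1) * E : ℝ) : EReal) := by
  have hnonneg : ∀ᵐ x ∂μ, 0 ≤ x := by
    rw [ae_iff]; simpa [Set.Iio] using hμ
  have hxi : Integrable (fun x : ℝ => x) μ :=
    ⟨aestronglyMeasurable_id, by
      rw [hasFiniteIntegral_iff_ofReal hnonneg]
      exact hmean.trans_lt ENNReal.ofReal_lt_top⟩
  have hxE : ∫ x, x ∂μ ≤ E := by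
    rw [integral_eq_lintegral_of_nonneg_ae hnonneg aestronglyMeasurable_id]
    exact ENNReal.toReal_le_of_le_ofReal hE.le hmean
  set P := μ.prod (gaussianReal 0 1) with hP
  have hs : Measurable (fun p : ℝ × ℝ => (p.1, p.1 + p.2)) := by fun_prop
  have hJ : gaussianJoint μ = P.map (fun p => (p.1, p.1 + p.2)) := rfl
  set L : ℝ × ℝ → ℝ := fun p => Real.log (gaussianPDF p.1 1 p.2 / outputPDF μ p.2).toReal
  have hLm : Measurable L := (measurable_infoDensity μ).ennreal_toReal.log
  set w : ℝ × ℝ → ℝ≥0∞ := fun p => ENNReal.ofReal (refDensity t p.2) / outputPDF μ p.2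
  have hwm : Measurable w := ((measurable_refDensity t).ennreal_ofReal.div
    (measurable_outputPDF μ)).comp measurable_snd
  have hwle : ∫⁻ p, w (p.1, p.1 + p.2) ∂P ≤ ENNReal.ofReal (1 + 2 * stdNormalPDF t / t) := by
    rw [← lintegral_map hwm hs, ← hJ, lintegral_refDensity_div_outputPDF]
    exact lintegral_refDensity_le ht
  have hws : Measurable (fun p : ℝ × ℝ => w (p.1, p.1 + p.2)) := hwm.comp hs
  have hwfin : ∫⁻ p, w (p.1, p.1 + p.2) ∂P ≠ ∞ := ne_top_of_le_ne_top ENNReal.ofReal_ne_top hwle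
  have hwi : Integrable (fun p : ℝ × ℝ => (w (p.1, p.1 + p.2)).toReal) P :=
    integrable_toReal_of_lintegral_ne_top hws.aemeasurable hwfin
  have hwint : ∫ p, (w (p.1, p.1 + p.2)).toReal ∂P ≤ 1 + 2 * stdNormalPDF t / t := by
    rw [integral_toReal hws.aemeasurable (ae_lt_top hws hwfin)]
    refine ENNReal.toReal_le_of_le_ofReal ?_ hwle
    unfold stdNormalPDF; positivity
  have hlow : Integrable (fun p : ℝ × ℝ => -(p.2 ^ 2 / 2)) P :=
    ((integrable_sq_gaussianReal.div_const 2).comp_snd μ).neg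
  have hx1 : Integrable (fun p : ℝ × ℝ => t * p.1 / 2) P :=
    ((hxi.const_mul t).div_const 2).comp_fst _
  have hzi : Integrable (fun z : ℝ => (1 + z ^ 2) / 2) (gaussianReal 0 1) :=
    ((integrable_const 1).add integrable_sq_gaussianReal).div_const 2
  have hx2 : Integrable (fun p : ℝ × ℝ => p.1 * ((1 + p.2 ^ 2) / 2)) P := hxi.mul_prod hzi
  have hup : Integrable (fun p : ℝ × ℝ => t * p.1 / 2 + p.1 * ((1 + p.2 ^ 2) / 2) +
      (w (p.1, p.1 + p.2)).toReal - 1) P := ((hx1.add hx2).add hwi).sub (integrable_const 1)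
  have hleup : ∀ᵐ p ∂P, L (p.1, p.1 + p.2) ≤ t * p.1 / 2 + p.1 * ((1 + p.2 ^ 2) / 2) +
      (w (p.1, p.1 + p.2)).toReal - 1 := by
    have : ∀ᵐ p ∂P, 0 ≤ p.1 := Measure.quasiMeasurePreserving_fst.ae hnonneg
    filter_upwards [this] with p hp
    exact log_infoDensity_add_le μ ht hp p.2
  have hLi : Integrable (fun p : ℝ × ℝ => L (p.1, p.1 + p.2)) P :=
    integrable_of_le_of_le (hLm.comp hs).aestronglyMeasurable
      (ae_of_all _ fun p => neg_le_log_infoDensity_add μ p.1 p.2) hleup hlow hup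
  refine gaussianMI_le_of_integral_le μ
    ((integrable_map_measure hLm.aestronglyMeasurable hs.aemeasurable).2 hLi) ?_
  rw [hJ, integral_map hs.aemeasurable hLm.aestronglyMeasurable]
  refine (integral_mono_ae hLi hup hleup).trans ?_
  have hI1 : ∫ p, t * p.1 / 2 ∂P = t / 2 * ∫ x, x ∂μ := by
    rw [hP, integral_fun_fst (fun x => t * x / 2), integral_div, integral_const_mul]
    simp; ring
  have hI2 : ∫ p, p.1 * ((1 + p.2 ^ 2) / 2) ∂P = ∫ x, x ∂μ := by
    rw [hP, integral_prod_mul (fun x : ℝ => x) (fun z : ℝ => (1 + z ^ 2) / 2), integral_div,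
      integral_add (integrable_const 1) integrable_sq_gaussianReal, integral_sq_gaussianReal]
    simp
  rw [integral_sub (f := fun p : ℝ × ℝ => t * p.1 / 2 + p.1 * ((1 + p.2 ^ 2) / 2) +
      (w (p.1, p.1 + p.2)).toReal) ((hx1.add hx2).add hwi) (integrable_const 1),
    integral_add (f := fun p : ℝ × ℝ => t * p.1 / 2 + p.1 * ((1 + p.2 ^ 2) / 2))
      (hx1.add hx2) hwi, integral_add hx1 hx2, hI1, hI2]
  simp only [integral_const, probReal_univ, one_smul]
  nlinarith

lemma two_mul_stdNormalPDF_div_le {t : ℝ} (ht : 0 < t) :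
    2 * stdNormalPDF t / t ≤ Real.exp (-t ^ 2 / 2) / (1 - Real.exp (-t ^ 2 / 2)) := by
  have he : 0 < Real.exp (-t ^ 2 / 2) := Real.exp_pos _
  have he1 : Real.exp (-t ^ 2 / 2) < 1 := Real.exp_lt_one_iff.2 (by nlinarith [sq_pos_of_pos ht])
  have he2 := Real.add_one_le_exp (-t ^ 2 / 2)
  have hs : 2 ≤ Real.sqrt (2 * Real.pi) :=
    Real.le_sqrt_of_sq_le (by nlinarith [Real.pi_gt_three])
  have het : 1 - Real.exp (-t ^ 2 / 2) ≤ t := by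
    rcases le_total 1 t with h | h <;> nlinarith
  have : 2 * stdNormalPDF t / t = Real.exp (-t ^ 2 / 2) * (2 / (Real.sqrt (2 * Real.pi) * t)) := by
    unfold stdNormalPDF; field_simp
  rw [this, div_eq_mul_inv (Real.exp _) (1 - _)]
  refine mul_le_mul_of_nonneg_left ?_ he.le
  rw [← one_div, div_le_div_iff₀ (by positivity) (by linarith)]
  nlinarith

theorem gaussian_capacity_duality_bound :
    ∀ E : ℝ, 0 < E → ∀ t : ℝ, 0 < t →
      C_G E ≤
        ((Real.exp (-t ^ 2 / 2) / (1 - Real.exp (-t ^ 2 / 2)) +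
            (t / 2 + 1) * stdNormalPDF t + 2 * E / t +
            (2 + 1 / (2 * Real.sqrt (2 * Real.pi))) * E + E * t / 2 : ℝ) : EReal) := by
  intro E hE t ht
  refine iSup_le fun μ => iSup_le fun hprob => iSup_le fun hμ => iSup_le fun hmean => ?_
  refine (gaussianMI_le μ hE ht hμ hmean).trans (EReal.coe_le_coe_iff.2 ?_)
  have h1 := two_mul_stdNormalPDF_div_le ht
  have h2 : 0 ≤ (t / 2 + 1) * stdNormalPDF t := by unfold stdNormalPDF; positivity
  have h3 : 0 ≤ 2 * E / t := by positivity
  have h4 : 0 ≤ 1 / (2 * Real.sqrt (2 * Real.pi)) * E := by positivity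
  nlinarith
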